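/- Let n ≥ 4 be even and let G be the cycle graph on n vertices, with eigenvalues 0 = λ₀ < λ₁ ≤ … ≤ λ_{n−1} of the normalized Laplacian 𝓛 = I − (1/2)A, and for η ∈ [0,1) define g(η) = max_{i=1,…,n−1} |η + (1−η)(1 − λᵢ)|. Then ς := (λ₁+λ_{n−1})/2 = 1 + sin²(π/n) > 1, the unique minimizer of g over [0,1) is η* = sin²(π/n) / (1 + sin²(π/n)), and the minimum value is g(η*) = (1 − sin²(π/n)) / (1 + sin²(π/n)). -/

import Mathlib

/-- The left eigenvector equation for the adjacency matrix of a cycle: if `z ^ n = 1`, then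
`j ↦ z ^ j` is an eigenvector with eigenvalue `z + z⁻¹`. -/
theorem sum_pow_mul_adjMatrix_cycleGraph {n : ℕ} (hn : 3 ≤ n) {z : ℂ} (hz : z ^ n = 1)
    (j : Fin n) :
    ∑ i : Fin n, z ^ (i : ℕ) * (SimpleGraph.cycleGraph n).adjMatrix ℂ i j
      = (z + z⁻¹) * z ^ (j : ℕ) := by
  obtain ⟨m, rfl⟩ : ∃ m, n = m + 3 := ⟨n - 3, by omega⟩
  have hz0 : z ≠ 0 := by
    rintro rfl
    simp at hz
  have hsucc (i : Fin (m + 3)) : z ^ ((i + 1 : Fin (m + 3)) : ℕ) = z ^ (i : ℕ) * z := by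
    rw [Fin.val_add, ← pow_eq_pow_mod _ hz, pow_add]
    simp
  have hpred : z ^ ((j - 1 : Fin (m + 3)) : ℕ) = z ^ (j : ℕ) * z⁻¹ := by
    rw [eq_mul_inv_iff_mul_eq₀ hz0, ← hsucc, sub_add_cancel]
  have hne : j - 1 ≠ j + 1 := by
    intro h
    have h2 : (1 + 1 : Fin (m + 3)) = 0 := by
      have := sub_eq_zero.mpr h.symm
      rwa [show j + 1 - (j - 1) = 1 + 1 by abel] at this
    simp [Fin.ext_iff, Fin.val_add, Nat.mod_eq_of_lt] at h2
  have hsum : ∑ i : Fin (m + 3),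
      z ^ (i : ℕ) * (SimpleGraph.cycleGraph (m + 3)).adjMatrix ℂ i j
        = ∑ i ∈ (SimpleGraph.cycleGraph (m + 3)).neighborFinset j, z ^ (i : ℕ) := by
    simp [SimpleGraph.adjMatrix_apply, SimpleGraph.neighborFinset_eq_filter,
      Finset.sum_filter, SimpleGraph.adj_comm]
  rw [hsum, SimpleGraph.cycleGraph_neighborFinset, Finset.sum_pair hne, hsucc, hpred]
  ring

/-- If the invertible matrix `C` intertwines two diagonal matrices, their diagonals agree up to a
permutation. -/
theorem exists_perm_of_diagonal_mul_eq_mul_diagonal {ι K : Type*} [Fintype ι] [DecidableEq ι]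
    [Field K] {C : Matrix ι ι K} (hC : C.det ≠ 0) {a b : ι → K}
    (h : Matrix.diagonal a * C = C * Matrix.diagonal b) :
    ∃ σ : Equiv.Perm ι, ∀ i, a (σ i) = b i := by
  rw [Matrix.det_apply] at hC
  obtain ⟨σ, -, hσ⟩ := Finset.exists_ne_zero_of_sum_ne_zero hC
  refine ⟨σ, fun i => ?_⟩
  have hi : C (σ i) i ≠ 0 := fun h0 => hσ (by
    rw [Finset.prod_eq_zero (f := fun j => C (σ j) j) (Finset.mem_univ i) h0, smul_zero])
  have := congrFun (congrFun h (σ i)) i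
  rw [Matrix.diagonal_mul, Matrix.mul_diagonal, mul_comm] at this
  exact mul_left_cancel₀ hi this

/-- The eigenvalues of the normalized Laplacian of the cycle graph. -/
theorem exists_perm_eigenvalue_cycleGraph {n : ℕ} (hn : 3 ≤ n) (lam : Fin n → ℝ)
    {P : Matrix (Fin n) (Fin n) ℝ} (hP : IsUnit P.det)
    (h : ((1 : Matrix (Fin n) (Fin n) ℝ)
          - (2 : ℝ)⁻¹ • (SimpleGraph.cycleGraph n).adjMatrix ℝ) * P
        = P * Matrix.diagonal lam) :
    ∃ σ : Equiv.Perm (Fin n), ∀ i,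
      lam i = 2 * Real.sin ((σ i : ℕ) * (Real.pi / n)) ^ 2 := by
  have hn0 : n ≠ 0 := by omega
  set ω : ℂ := Complex.exp (2 * Real.pi * Complex.I / n) with hω
  have hprim : IsPrimitiveRoot ω n := Complex.isPrimitiveRoot_exp n hn0
  set V : Matrix (Fin n) (Fin n) ℂ := Matrix.vandermonde fun k : Fin n => ω ^ (k : ℕ) with hV
  set Q : Matrix (Fin n) (Fin n) ℂ := P.map Complex.ofRealHom with hQ
  have hVdet : V.det ≠ 0 := Matrix.det_vandermonde_ne_zero_iff.mpr fun a b hab =>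
    Fin.ext (hprim.pow_inj a.2 b.2 hab)
  have hQdet : Q.det ≠ 0 := by
    have : Q.det = Complex.ofRealHom P.det := (RingHom.map_det Complex.ofRealHom P).symm
    rw [this]
    simpa using hP.ne_zero
  set L : Matrix (Fin n) (Fin n) ℂ :=
    1 - (2 : ℂ)⁻¹ • (SimpleGraph.cycleGraph n).adjMatrix ℂ with hL
  have hLQ : L * Q = Q * Matrix.diagonal fun i => (lam i : ℂ) := by
    have := congrArg (fun M => M.map Complex.ofRealHom) h
    simp only [Matrix.map_mul] at this
    convert this using 2
    · ext i j
      by_cases hij : i = j <;> by_cases hadj : (SimpleGraph.cycleGraph n).Adj i j <;>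
        simp [hL, SimpleGraph.adjMatrix_apply, hij, hadj]
    · ext i j
      by_cases hij : i = j <;> simp [hij]
  have hVL : Matrix.diagonal (fun k : Fin n =>
      ((2 * Real.sin ((k : ℕ) * (Real.pi / n)) ^ 2 : ℝ) : ℂ)) * V = V * L := by
    ext k j
    have hz : (ω ^ (k : ℕ)) ^ n = 1 := by
      rw [← pow_mul, mul_comm, pow_mul, hprim.pow_eq_one, one_pow]
    have hadj := sum_pow_mul_adjMatrix_cycleGraph hn hz j
    have hval : ω ^ (k : ℕ) + (ω ^ (k : ℕ))⁻¹
        = 2 - 2 * ((2 * Real.sin ((k : ℕ) * (Real.pi / n)) ^ 2 : ℝ) : ℂ) := by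
      have hexp : ω ^ (k : ℕ) = Complex.exp ((2 * ((k : ℕ) * (Real.pi / n)) : ℂ) * Complex.I) := by
        rw [hω, ← Complex.exp_nat_mul]
        congr 1
        ring
      rw [hexp, ← Complex.exp_neg, ← neg_mul, ← Complex.two_cos, Complex.cos_two_mul,
        Complex.cos_sq']
      push_cast
      ring
    have hmul : (V * (SimpleGraph.cycleGraph n).adjMatrix ℂ) k j
        = (ω ^ (k : ℕ) + (ω ^ (k : ℕ))⁻¹) * V k j := by
      simpa only [Matrix.mul_apply, hV, Matrix.vandermonde_apply] using hadj
    rw [Matrix.diagonal_mul, hL, mul_sub, mul_one, Matrix.mul_smul, Matrix.sub_apply,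
      Matrix.smul_apply, hmul, hval, smul_eq_mul]
    ring
  obtain ⟨σ, hσ⟩ := exists_perm_of_diagonal_mul_eq_mul_diagonal
    (C := V * Q) (by rw [Matrix.det_mul]; exact mul_ne_zero hVdet hQdet)
    (by rw [← mul_assoc, hVL, mul_assoc, hLQ, mul_assoc])
  exact ⟨σ, fun i => (Complex.ofReal_injective (hσ i)).symm⟩

theorem sin_pi_div_le_sin_mul_pi_div {n k : ℕ} (hk : 1 ≤ k) (hkn : k < n) :
    Real.sin (Real.pi / n) ≤ Real.sin (k * (Real.pi / n)) := by
  have hn : (0 : ℝ) < n := by exact_mod_cast (by omega : 0 < n)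
  have hpi := Real.pi_pos
  have hx : 0 < Real.pi / n := by positivity
  have hnx : n * (Real.pi / n) = Real.pi := by field_simp
  have hk' : (1 : ℝ) ≤ k := by exact_mod_cast hk
  have hkn' : (k : ℝ) + 1 ≤ n := by exact_mod_cast hkn
  have hlow : Real.pi / n ≤ k * (Real.pi / n) := by nlinarith
  have hupp : k * (Real.pi / n) + Real.pi / n ≤ Real.pi := by nlinarith
  rcases le_total (k * (Real.pi / n)) (Real.pi / 2) with h | h
  · exact Real.sin_le_sin_of_le_of_le_pi_div_two (by linarith) h hlow
  · rw [← Real.sin_pi_sub (k * (Real.pi / n))]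
    exact Real.sin_le_sin_of_le_of_le_pi_div_two (by linarith) (by linarith) (by linarith)

open Real in
/-- For even `n ≥ 4` and the cycle graph on `n` vertices, with
eigenvalues `0 = λ₀ < λ₁ ≤ … ≤ λ_{n-1}` of the normalized Laplacian `𝓛 = I - (1/2)A`
(listed with multiplicity in increasing order, via a diagonalization) and
`g(η) = max_{i=1,…,n-1} |η + (1-η)(1-λᵢ)|` for `η ∈ [0,1)`:
`ς = (λ₁+λ_{n-1})/2 = 1 + sin²(π/n) > 1`, the unique minimizer of `g` over `[0,1)` is
`η* = sin²(π/n)/(1+sin²(π/n))`, and the minimum value is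
`g(η*) = (1-sin²(π/n))/(1+sin²(π/n))`. -/
theorem stmt_17 {n : ℕ} (hn : 4 ≤ n) (heven : Even n)
    (lam : Fin n → ℝ) (hmono : Monotone lam) (hlam0 : lam ⟨0, by omega⟩ = 0)
    (hdiag : ∃ P : Matrix (Fin n) (Fin n) ℝ, IsUnit P.det ∧
      ((1 : Matrix (Fin n) (Fin n) ℝ)
          - (2 : ℝ)⁻¹ • (SimpleGraph.cycleGraph n).adjMatrix ℝ) * P
        = P * Matrix.diagonal lam)
    (g : ℝ → ℝ)
    (hg : ∀ η : ℝ, g η = Finset.sup' (Finset.univ.erase (⟨0, by omega⟩ : Fin n))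
      ⟨⟨1, by omega⟩, by simp [Finset.mem_erase, Fin.ext_iff]⟩
      fun i => |η + (1 - η) * (1 - lam i)|) :
    (lam ⟨1, by omega⟩ + lam ⟨n - 1, by omega⟩) / 2 = 1 + sin (π / n) ^ 2
    ∧ 1 < (lam ⟨1, by omega⟩ + lam ⟨n - 1, by omega⟩) / 2
    ∧ sin (π / n) ^ 2 / (1 + sin (π / n) ^ 2) ∈ Set.Ico (0 : ℝ) 1
    ∧ (∀ η ∈ Set.Ico (0 : ℝ) 1, η ≠ sin (π / n) ^ 2 / (1 + sin (π / n) ^ 2) →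
        g (sin (π / n) ^ 2 / (1 + sin (π / n) ^ 2)) < g η)
    ∧ g (sin (π / n) ^ 2 / (1 + sin (π / n) ^ 2))
        = (1 - sin (π / n) ^ 2) / (1 + sin (π / n) ^ 2) := by
  obtain ⟨P, hP, hPD⟩ := hdiag
  obtain ⟨σ, hσ⟩ := exists_perm_eigenvalue_cycleGraph (by omega) lam hP hPD
  have hnR : (4 : ℝ) ≤ n := by exact_mod_cast hn
  have hsin : 0 < sin (π / n) :=
    sin_pos_of_pos_of_lt_pi (by positivity) (div_lt_self pi_pos (by linarith))
  set s : ℝ := sin (π / n) ^ 2 with hs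
  have hs0 : 0 < s := by positivity
  have hs1 : s ≤ 1 := sin_sq_le_one _
  have hlow (i : Fin n) (hi : (σ i : ℕ) ≠ 0) : 2 * s ≤ lam i := by
    rw [hσ, hs]
    have := sin_pi_div_le_sin_mul_pi_div (by omega : 1 ≤ (σ i : ℕ)) (σ i).2
    gcongr
  have hupp (i : Fin n) : lam i ≤ 2 := by
    rw [hσ]
    linarith [sin_sq_le_one ((σ i : ℕ) * (π / n))]
  have hσ0 : (σ ⟨0, by omega⟩ : ℕ) = 0 := by
    by_contra h
    linarith [hlow _ h]
  have hlow' (i : Fin n) (hi : i ≠ ⟨0, by omega⟩) : 2 * s ≤ lam i :=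
    hlow i fun h => hi (σ.injective (Fin.ext (h.trans hσ0.symm)))
  have h1 : lam ⟨1, by omega⟩ = 2 * s := by
    refine le_antisymm ?_ (hlow' _ (by simp [Fin.ext_iff]))
    have hval : lam (σ.symm ⟨1, by omega⟩) = 2 * s := by simp [hσ, hs]
    rw [← hval]
    apply hmono
    rw [Fin.le_def]
    refine Nat.one_le_iff_ne_zero.mpr fun h => ?_
    rw [show σ.symm ⟨1, by omega⟩ = ⟨0, by omega⟩ from Fin.ext h] at hval
    linarith
  have hlast : lam ⟨n - 1, by omega⟩ = 2 := by
    refine le_antisymm (hupp _) ?_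
    obtain ⟨m, hm⟩ := heven
    have hval : lam (σ.symm ⟨m, by omega⟩) = 2 := by
      have : (m : ℝ) * (π / n) = π / 2 := by
        have hnm : (n : ℝ) = m + m := by exact_mod_cast hm
        have hm0 : (m : ℝ) ≠ 0 := by
          intro h
          linarith
        rw [hnm]
        field_simp
        ring
      simp [hσ, this]
    rw [← hval]
    apply hmono
    rw [Fin.le_def]
    exact Nat.le_sub_one_of_lt (Fin.is_lt _)
  have hgle (η : ℝ) (i : Fin n) (hi : i ≠ ⟨0, by omega⟩) :
      |η + (1 - η) * (1 - lam i)| ≤ g η := by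
    rw [hg]
    exact Finset.le_sup' (fun i => |η + (1 - η) * (1 - lam i)|)
      (Finset.mem_erase.mpr ⟨hi, Finset.mem_univ i⟩)
  have hg1 (η : ℝ) : η + (1 - η) * (1 - 2 * s) ≤ g η := by
    have := hgle η ⟨1, by omega⟩ (by simp [Fin.ext_iff])
    rw [h1] at this
    exact (le_abs_self _).trans this
  have hg2 (η : ℝ) : -(η + (1 - η) * (1 - 2)) ≤ g η := by
    have := hgle η ⟨n - 1, by omega⟩ (by simp [Fin.ext_iff]; omega)
    rw [hlast] at this
    exact (neg_le_abs _).trans this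
  set e : ℝ := s / (1 + s) with he
  have hes : e * (1 + s) = s := by
    rw [he]
    field_simp
  have he1 : e < 1 := by
    rw [he, div_lt_one (by linarith)]
    linarith
  have hmin : (1 - s) / (1 + s) = 1 - 2 * e := by
    rw [he]
    field_simp
    ring
  have hge : g e = 1 - 2 * e := by
    refine le_antisymm ?_ ?_
    · rw [hg]
      refine Finset.sup'_le _ _ fun i hi => ?_
      have hi' := hlow' i (Finset.mem_erase.mp hi).1
      have hi2 := hupp i
      rw [abs_le]
      constructor <;> nlinarith
    · have := hg1 e
      nlinarith
  rw [h1, hlast, hmin]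
  refine ⟨by ring, by linarith, ⟨by positivity, he1⟩, fun η _ hne => ?_, hge⟩
  rw [hge]
  rcases lt_or_gt_of_ne hne with h | h
  · linarith [hg2 η]
  · have := hg1 η
    nlinarith [mul_pos hs0 (sub_pos.mpr h)]
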